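/- Let F be a field, V an F-vector space of dimension at least 3, and Π a subspace of V* with ann_V(Π) = {0}. For a 1-dimensional subspace p of V, let p̄ denote the set of points of Γ(V,Π) whose first coordinate is p, and for H = ker φ with 0 ≠ φ ∈ Π, let H̄ denote the set of points of Γ(V,Π) whose second coordinate is H; let 𝒞 be the collection of all sets p̄ and all sets H̄. Then for C₁, C₂ ∈ 𝒞, the following are equivalent: (i) C₁ and C₂ belong to the same part of the partition, i.e., both are of the form p̄ or both are of the form H̄; (ii) there exists C₃ ∈ 𝒞 with C₃ ≠ C₁, C₃ ≠ C₂, C₁ ∩ C₃ ≠ ∅ and C₂ ∩ C₃ ≠ ∅. -/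

import Mathlib

/-- The point set of the geometry `Γ(V,Π)`: incident point–hyperplane pairs `(p, H)` with
`p` a 1-dimensional subspace of `V` and `H` the kernel of some nonzero `φ ∈ Π`. -/
def GammaPoint (F : Type*) [Field F] (V : Type*) [AddCommGroup V] [Module F V]
    (Pi : Submodule F (Module.Dual F V)) : Set (Submodule F V × Submodule F V) :=
  {x | Module.finrank F x.1 = 1 ∧ (∃ φ ∈ Pi, φ ≠ 0 ∧ x.2 = LinearMap.ker φ) ∧ x.1 ≤ x.2}

/-- The lines of the geometry `Γ(V,Π)`: either all points `(r, ker φ)` with `r` running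
over the 1-dimensional subspaces of a fixed 2-dimensional `W ≤ ker φ`, or all points
`(p, ker ψ)` with `ψ` running over the nonzero elements of a fixed 2-dimensional subspace
`Ψ` of `Π` all of whose elements vanish on `p`. -/
def IsGammaLine (F : Type*) [Field F] (V : Type*) [AddCommGroup V] [Module F V]
    (Pi : Submodule F (Module.Dual F V)) (L : Set (Submodule F V × Submodule F V)) : Prop :=
  (∃ (W : Submodule F V) (φ : Module.Dual F V), Module.finrank F W = 2 ∧ φ ∈ Pi ∧ φ ≠ 0 ∧
      W ≤ LinearMap.ker φ ∧
      L = {x | ∃ r : Submodule F V,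
            Module.finrank F r = 1 ∧ r ≤ W ∧ x = (r, LinearMap.ker φ)}) ∨
  (∃ (p : Submodule F V) (Psi : Submodule F (Module.Dual F V)), Module.finrank F p = 1 ∧
      Module.finrank F Psi = 2 ∧ Psi ≤ Pi ∧ (∀ ψ ∈ Psi, p ≤ LinearMap.ker ψ) ∧
      L = {x | ∃ ψ ∈ Psi, ψ ≠ 0 ∧ x = (p, LinearMap.ker ψ)})

/-- For a 1-dimensional subspace `p` of `V`, the maximal clique of all points of
`Γ(V,Π)` with first coordinate `p`. -/
def PbarCliques (F : Type*) [Field F] (V : Type*) [AddCommGroup V] [Module F V]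
    (Pi : Submodule F (Module.Dual F V)) : Set (Set (Submodule F V × Submodule F V)) :=
  {C | ∃ p : Submodule F V, Module.finrank F p = 1 ∧
    C = {x ∈ GammaPoint F V Pi | x.1 = p}}

/-- For a hyperplane `H = ker φ` with nonzero `φ ∈ Π`, the maximal clique of all points
of `Γ(V,Π)` with second coordinate `H`. -/
def HbarCliques (F : Type*) [Field F] (V : Type*) [AddCommGroup V] [Module F V]
    (Pi : Submodule F (Module.Dual F V)) : Set (Set (Submodule F V × Submodule F V)) :=
  {C | ∃ φ ∈ Pi, φ ≠ (0 : Module.Dual F V) ∧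
    C = {x ∈ GammaPoint F V Pi | x.2 = LinearMap.ker φ}}

/-- A space of rank at least three does not embed in a space of dimension at most two. -/
theorem not_injective_of_three_le_rank {F V M : Type*} [Field F] [AddCommGroup V] [Module F V]
    [AddCommGroup M] [Module F M] [FiniteDimensional F M] (hV : 3 ≤ Module.rank F V)
    (hM : Module.finrank F M ≤ 2) (f : V →ₗ[F] M) : ¬ Function.Injective f := by
  intro hf
  have : FiniteDimensional F V := FiniteDimensional.of_injective f hf
  have hle := LinearMap.finrank_le_finrank_of_injective hf
  rw [← Module.finrank_eq_rank] at hV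
  have : 3 ≤ Module.finrank F V := by exact_mod_cast hV
  omega

/-- Two functionals on a space of rank at least three have a common nonzero zero. -/
theorem exists_ne_zero_common_zero {F V : Type*} [Field F] [AddCommGroup V] [Module F V]
    (hV : 3 ≤ Module.rank F V) (φ ψ : Module.Dual F V) :
    ∃ v : V, v ≠ 0 ∧ φ v = 0 ∧ ψ v = 0 := by
  have h := not_injective_of_three_le_rank hV (by simp) (φ.prod ψ)
  rw [injective_iff_map_eq_zero] at h
  push Not at h
  obtain ⟨v, hv, hv0⟩ := h
  exact ⟨v, hv0, congrArg Prod.fst hv, congrArg Prod.snd hv⟩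

/-- The functionals parametrized by a space of dimension at most two have a common nonzero zero
in any space of rank at least three. -/
theorem exists_ne_zero_forall_apply_eq_zero {F V W : Type*} [Field F] [AddCommGroup V]
    [Module F V] [AddCommGroup W] [Module F W] [FiniteDimensional F W]
    (hV : 3 ≤ Module.rank F V) (hW : Module.finrank F W ≤ 2) (B : W →ₗ[F] Module.Dual F V) :
    ∃ v : V, v ≠ 0 ∧ ∀ w, B w v = 0 := by
  have h := not_injective_of_three_le_rank hV (M := Module.Dual F W)
    (by rwa [Subspace.dual_finrank_eq]) B.flip
  rw [injective_iff_map_eq_zero] at h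
  push Not at h
  obtain ⟨v, hv, hv0⟩ := h
  exact ⟨v, hv0, fun w => LinearMap.congr_fun hv w⟩

/-- If `Π` has trivial annihilator in a space of rank at least three, then any two vectors are
killed by a common nonzero element of `Π`. -/
theorem exists_ne_zero_mem_vanishing {F V : Type*} [Field F] [AddCommGroup V] [Module F V]
    (hV : 3 ≤ Module.rank F V) (Pi : Submodule F (Module.Dual F V))
    (hann : ∀ v : V, (∀ φ ∈ Pi, φ v = 0) → v = 0) (v w : V) :
    ∃ φ ∈ Pi, φ ≠ 0 ∧ φ v = 0 ∧ φ w = 0 := by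
  by_contra! h
  let e : Pi →ₗ[F] F × F :=
    ((Module.Dual.eval F V v).prod (Module.Dual.eval F V w)).comp Pi.subtype
  have he : Function.Injective e := by
    rw [injective_iff_map_eq_zero]
    intro φ hφ
    by_contra hne
    have hφ' : φ.1 v = 0 ∧ φ.1 w = 0 := by simpa [e] using hφ
    exact h φ.1 φ.2 (by simpa using hne) hφ'.1 hφ'.2
  have : FiniteDimensional F Pi := FiniteDimensional.of_injective e he
  have hle : Module.finrank F Pi ≤ 2 := by
    simpa using LinearMap.finrank_le_finrank_of_injective he
  obtain ⟨x, hx0, hx⟩ := exists_ne_zero_forall_apply_eq_zero (W := Pi) hV hle Pi.subtype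
  exact hx0 (hann x fun φ hφ => hx ⟨φ, hφ⟩)

/-- The clique of a 1-dimensional subspace is never the clique of a hyperplane. -/
theorem pbar_ne_hbar {F V : Type*} [Field F] [AddCommGroup V] [Module F V]
    (hV : 3 ≤ Module.rank F V) (Pi : Submodule F (Module.Dual F V))
    (hann : ∀ v : V, (∀ φ ∈ Pi, φ v = 0) → v = 0) {p : Submodule F V}
    (hp : Module.finrank F p = 1) {φ : Module.Dual F V} (hφ : φ ∈ Pi) (hφ0 : φ ≠ 0) :
    {x ∈ GammaPoint F V Pi | x.1 = p} ≠ {x ∈ GammaPoint F V Pi | x.2 = LinearMap.ker φ} := by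
  intro h
  obtain ⟨⟨v, hv⟩, hv0, -⟩ := finrank_eq_one_iff'.1 hp
  have hv0 : v ≠ 0 := by simpa using hv0
  obtain ⟨ψ, -, hψv⟩ : ∃ ψ ∈ Pi, ψ v ≠ 0 := by
    by_contra! hψ
    exact hv0 (hann v hψ)
  obtain ⟨u, hu0, hu, hψu⟩ := exists_ne_zero_common_zero hV φ ψ
  have hmem : (F ∙ u, LinearMap.ker φ) ∈ {x ∈ GammaPoint F V Pi | x.1 = p} := by
    rw [h]
    exact ⟨⟨finrank_span_singleton hu0, ⟨φ, hφ, hφ0, rfl⟩, by simpa using hu⟩, rfl⟩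
  obtain ⟨-, rfl⟩ := hmem
  obtain ⟨c, rfl⟩ := Submodule.mem_span_singleton.1 hv
  simp [hψu] at hψv

/-- The cliques of `p` and of `ker φ` meet when `p ≤ ker φ`. -/
theorem pbar_inter_hbar_nonempty {F V : Type*} [Field F] [AddCommGroup V] [Module F V]
    (Pi : Submodule F (Module.Dual F V)) {p : Submodule F V} (hp : Module.finrank F p = 1)
    {φ : Module.Dual F V} (hφ : φ ∈ Pi) (hφ0 : φ ≠ 0) (h : p ≤ LinearMap.ker φ) :
    ({x ∈ GammaPoint F V Pi | x.1 = p} ∩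
      {x ∈ GammaPoint F V Pi | x.2 = LinearMap.ker φ}).Nonempty :=
  ⟨(p, LinearMap.ker φ), ⟨⟨hp, ⟨φ, hφ, hφ0, rfl⟩, h⟩, rfl⟩, ⟨hp, ⟨φ, hφ, hφ0, rfl⟩, h⟩, rfl⟩

/-- Meeting cliques of 1-dimensional subspaces coincide. -/
theorem eq_of_mem_pbarCliques {F V : Type*} [Field F] [AddCommGroup V] [Module F V]
    {Pi : Submodule F (Module.Dual F V)} {C D : Set (Submodule F V × Submodule F V)}
    (hC : C ∈ PbarCliques F V Pi) (hD : D ∈ PbarCliques F V Pi) (h : (C ∩ D).Nonempty) :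
    D = C := by
  obtain ⟨p, -, rfl⟩ := hC
  obtain ⟨q, -, rfl⟩ := hD
  obtain ⟨x, ⟨-, rfl⟩, -, rfl⟩ := h
  rfl

/-- Meeting cliques of hyperplanes coincide. -/
theorem eq_of_mem_hbarCliques {F V : Type*} [Field F] [AddCommGroup V] [Module F V]
    {Pi : Submodule F (Module.Dual F V)} {C D : Set (Submodule F V × Submodule F V)}
    (hC : C ∈ HbarCliques F V Pi) (hD : D ∈ HbarCliques F V Pi) (h : (C ∩ D).Nonempty) :
    D = C := by
  obtain ⟨φ, -, -, rfl⟩ := hC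
  obtain ⟨ψ, -, -, rfl⟩ := hD
  obtain ⟨x, ⟨-, hφ⟩, -, hψ⟩ := h
  rw [← hφ, ← hψ]

/-- Two maximal cliques of `Γ(V,Π)` belong to the same part of the partition
(both point-type, or both hyperplane-type) if and only if there is a third maximal
clique meeting both. -/
theorem same_part_iff_third_clique (F : Type*) [Field F] (V : Type*) [AddCommGroup V]
    [Module F V] (hV : 3 ≤ Module.rank F V) (Pi : Submodule F (Module.Dual F V))
    (hann : ∀ v : V, (∀ φ ∈ Pi, φ v = 0) → v = 0)
    (C₁ C₂ : Set (Submodule F V × Submodule F V))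
    (h1 : C₁ ∈ PbarCliques F V Pi ∪ HbarCliques F V Pi)
    (h2 : C₂ ∈ PbarCliques F V Pi ∪ HbarCliques F V Pi) :
    ((C₁ ∈ PbarCliques F V Pi ∧ C₂ ∈ PbarCliques F V Pi) ∨
        (C₁ ∈ HbarCliques F V Pi ∧ C₂ ∈ HbarCliques F V Pi)) ↔
      ∃ C₃ ∈ PbarCliques F V Pi ∪ HbarCliques F V Pi,
        C₃ ≠ C₁ ∧ C₃ ≠ C₂ ∧ (C₁ ∩ C₃).Nonempty ∧ (C₂ ∩ C₃).Nonempty := by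
  constructor
  · rintro (⟨⟨p, hp, rfl⟩, ⟨q, hq, rfl⟩⟩ | ⟨⟨φ, hφ, hφ0, rfl⟩, ⟨ψ, hψ, hψ0, rfl⟩⟩)
    · obtain ⟨v, -, hv⟩ := finrank_eq_one_iff'.1 hp
      obtain ⟨w, -, hw⟩ := finrank_eq_one_iff'.1 hq
      obtain ⟨φ, hφ, hφ0, hφv, hφw⟩ := exists_ne_zero_mem_vanishing hV Pi hann v.1 w.1
      have hpφ : p ≤ LinearMap.ker φ := by
        intro x hx
        obtain ⟨c, hc⟩ := hv ⟨x, hx⟩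
        obtain rfl : c • v.1 = x := congrArg Subtype.val hc
        simp [hφv]
      have hqφ : q ≤ LinearMap.ker φ := by
        intro x hx
        obtain ⟨c, hc⟩ := hw ⟨x, hx⟩
        obtain rfl : c • w.1 = x := congrArg Subtype.val hc
        simp [hφw]
      exact ⟨_, Or.inr ⟨φ, hφ, hφ0, rfl⟩, (pbar_ne_hbar hV Pi hann hp hφ hφ0).symm,
        (pbar_ne_hbar hV Pi hann hq hφ hφ0).symm, pbar_inter_hbar_nonempty Pi hp hφ hφ0 hpφ,
        pbar_inter_hbar_nonempty Pi hq hφ hφ0 hqφ⟩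
    · obtain ⟨v, hv0, hφv, hψv⟩ := exists_ne_zero_common_zero hV φ ψ
      have hp : Module.finrank F (F ∙ v) = 1 := finrank_span_singleton hv0
      refine ⟨_, Or.inl ⟨F ∙ v, hp, rfl⟩, pbar_ne_hbar hV Pi hann hp hφ hφ0,
        pbar_ne_hbar hV Pi hann hp hψ hψ0, ?_, ?_⟩
      · rw [Set.inter_comm]
        exact pbar_inter_hbar_nonempty Pi hp hφ hφ0 (by simpa using hφv)
      · rw [Set.inter_comm]
        exact pbar_inter_hbar_nonempty Pi hp hψ hψ0 (by simpa using hψv)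
  · rintro ⟨C₃, h3 | h3, h31, h32, h13, h23⟩
    · exact Or.inr ⟨h1.resolve_left fun h => h31 (eq_of_mem_pbarCliques h h3 h13),
        h2.resolve_left fun h => h32 (eq_of_mem_pbarCliques h h3 h23)⟩
    · exact Or.inl ⟨h1.resolve_right fun h => h31 (eq_of_mem_hbarCliques h h3 h13),
        h2.resolve_right fun h => h32 (eq_of_mem_hbarCliques h h3 h23)⟩
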